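/- For every nonnegative integer n, the total number of pairs (S, f), where S ⊆ Fin n and f : Fin 3 × Fin n → Option (Fin 3) satisfies: (i) f(c,d) = none if and only if d ∉ S; (ii) whenever f(c,d) = some p, then p ≠ c; and (iii) for each player p ∈ Fin 3, the set of cards mapped to some p has cardinality |S|, equals ∑_{k=0}^{n} C(n,k) · (∑_{j=0}^{k} C(k,j)^3), and also equals ∑_{k=0}^{n} C(n,k)^2 · C(2k,k). -/

import Mathlib

open Polynomial in
theorem Polynomial.coeff_C_add_C_mul_X_pow {R : Type*} [CommSemiring R] (a b : R) (n i : ℕ) :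
    ((C a + C b * X) ^ n).coeff i = a ^ (n - i) * b ^ i * n.choose i := by
  rw [add_comm, add_pow, finsetSum_coeff]
  have h (m : ℕ) : ((C b * X) ^ m * C a ^ (n - m) * (n.choose m : R[X])).coeff i =
      if i = m then a ^ (n - i) * b ^ i * n.choose i else 0 := by
    rw [show (C b * X) ^ m * C a ^ (n - m) * (n.choose m : R[X]) =
      C (a ^ (n - m) * b ^ m * n.choose m) * X ^ m by
        simp only [C_mul, C_pow, C_eq_natCast]; ring, coeff_C_mul_X_pow]
    split_ifs with hm
    · rw [hm]
    · rfl
  simp only [h, Finset.sum_ite_eq, Finset.mem_range]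
  split_ifs with hi
  · rfl
  · rw [Nat.choose_eq_zero_of_lt (by omega)]; simp

open Polynomial Finset in
theorem sum_choose_mul_sum_choose_pow_three (n : ℕ) :
    ∑ k ∈ range (n + 1), n.choose k * ∑ j ∈ range (k + 1), (k.choose j) ^ 3 =
      ∑ k ∈ range (n + 1), (n.choose k) ^ 2 * (2 * k).choose k := by
  -- compare the coefficients of `x ^ n * y ^ n`, where `x = C X` and `y = X`
  have key : ((C X * X + C (1 + X) * ((C 1 + C 1 * X) * (C X + C 1 * X))) ^ n : ℤ[X][X]) =
      (C (1 + X) + C 1 * X) ^ n * (C X + C (1 + X) * X) ^ n := by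
    rw [← mul_pow]
    congr 1
    simp only [C_add, C_1]
    ring
  have hX (p : ℤ[X][X]) (k : ℕ) (hk : k ≤ n) :
      (((C X * X) ^ (n - k) * p).coeff n).coeff n = (p.coeff k).coeff k := by
    obtain ⟨m, rfl⟩ := Nat.exists_eq_add_of_le hk
    rw [Nat.add_sub_cancel_left, mul_pow, ← C_pow, mul_assoc, coeff_C_mul, coeff_X_pow_mul,
      coeff_X_pow_mul]
  have hL (k : ℕ) : (((C (1 + X) * ((C 1 + C 1 * X) * (C X + C 1 * X))) ^ k : ℤ[X][X]).coeff
      k).coeff k = ((∑ j ∈ range (k + 1), (k.choose j) ^ 3 : ℕ) : ℤ) := by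
    rw [Nat.cast_sum, mul_pow, mul_pow, ← C_pow, coeff_C_mul, coeff_mul ((C 1 + C 1 * X) ^ k),
      Nat.sum_antidiagonal_eq_sum_range_succ_mk,
      mul_sum, finsetSum_coeff]
    refine sum_congr rfl fun j hj => ?_
    have hj : j ≤ k := by simpa [Nat.lt_succ_iff] using hj
    rw [coeff_C_add_C_mul_X_pow, coeff_C_add_C_mul_X_pow, Nat.sub_sub_self hj,
      Nat.choose_symm hj]
    simp only [one_pow, one_mul, mul_one]
    rw [show (1 + X : ℤ[X]) ^ k * ((k.choose j : ℤ[X]) * (X ^ j * (k.choose j : ℤ[X]))) =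
      (1 + X) ^ k * ((k.choose j * k.choose j : ℕ) : ℤ[X]) * X ^ j by push_cast; ring,
      coeff_mul_X_pow', if_pos hj, coeff_mul_natCast, coeff_one_add_X_pow, Nat.choose_symm hj]
    push_cast
    ring
  have hR : (((C (1 + X) + C 1 * X) ^ n * (C X + C (1 + X) * X) ^ n : ℤ[X][X]).coeff n).coeff n =
      ((∑ k ∈ range (n + 1), (n.choose k) ^ 2 * (2 * k).choose k : ℕ) : ℤ) := by
    rw [Nat.cast_sum, coeff_mul, Nat.sum_antidiagonal_eq_sum_range_succ_mk, finsetSum_coeff,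
      ← sum_range_reflect]
    refine sum_congr rfl fun j hj => ?_
    have hj : j ≤ n := by simpa [Nat.lt_succ_iff] using hj
    rw [coeff_C_add_C_mul_X_pow, coeff_C_add_C_mul_X_pow,
      show n + 1 - 1 - j = n - j by omega, Nat.sub_sub_self hj, Nat.choose_symm hj]
    simp only [one_pow, mul_one]
    rw [show (1 + X : ℤ[X]) ^ j * (n.choose j : ℤ[X]) *
      (X ^ (n - j) * (1 + X) ^ j * (n.choose j : ℤ[X])) =
      (1 + X) ^ (2 * j) * ((n.choose j * n.choose j : ℕ) : ℤ[X]) * X ^ (n - j) by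
        push_cast; ring,
      coeff_mul_X_pow', if_pos (Nat.sub_le _ _), coeff_mul_natCast, coeff_one_add_X_pow,
      Nat.sub_sub_self hj]
    push_cast
    ring
  rw [← Nat.cast_inj (R := ℤ), ← hR, ← key, add_comm (C X * X), add_pow, Nat.cast_sum,
    finsetSum_coeff, finsetSum_coeff]
  refine sum_congr rfl fun k hk => ?_
  have hk : k ≤ n := by simpa [Nat.lt_succ_iff] using hk
  rw [mul_comm _ ((C X * X) ^ (n - k)), coeff_mul_natCast, ← C_eq_natCast, coeff_mul_C, hX _ _ hk,
    hL, Nat.cast_mul, mul_comm]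

/-- The denominations of the cards of color `c` given to player `p`. -/
def dealtTo {n : ℕ} (f : Fin 3 × Fin n → Option (Fin 3)) (c p : Fin 3) : Finset (Fin n) :=
  Finset.univ.filter fun d => f (c, d) = some p

open Finset in
theorem card_hand {n : ℕ} (f : Fin 3 × Fin n → Option (Fin 3)) (p : Fin 3) :
    (univ.filter fun x => f x = some p).card =
      (dealtTo f 0 p).card + (dealtTo f 1 p).card + (dealtTo f 2 p).card := by
  simp only [dealtTo, card_filter, Fintype.sum_prod_type, Fin.sum_univ_three]

open Finset in
theorem card_dealtTo_add_card_dealtTo {n : ℕ} {S : Finset (Fin n)}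
    {f : Fin 3 × Fin n → Option (Fin 3)} (hS : ∀ x, f x = none ↔ x.2 ∉ S)
    (hf : ∀ x p, f x = some p → p ≠ x.1) (c : Fin 3) :
    (dealtTo f c (c + 1)).card + (dealtTo f c (c + 2)).card = S.card := by
  rw [← card_union_of_disjoint]
  · congr 1
    ext d
    have h1 := hS (c, d)
    have h2 := hf (c, d)
    simp only [dealtTo, mem_union, mem_filter, mem_univ, true_and]
    generalize f (c, d) = o at h1 h2
    rcases o with _ | p
    · simpa using h1
    · have h3 : p ≠ c := h2 p rfl
      have h4 : d ∈ S := by simpa using h1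
      simp only [Option.some.injEq, h4, iff_true]
      revert h3
      clear h1 h2
      revert p c
      decide
  · rw [disjoint_left]
    intro d h1 h2
    simp only [dealtTo, mem_filter, mem_univ, true_and] at h1 h2
    rw [h1, Option.some.injEq] at h2
    revert h2
    clear h1
    revert c
    decide

theorem dealtTo_self {n : ℕ} {f : Fin 3 × Fin n → Option (Fin 3)}
    (hf : ∀ x p, f x = some p → p ≠ x.1) (c : Fin 3) : dealtTo f c c = ∅ := by
  ext d
  simpa [dealtTo] using fun h => hf (c, d) c h rfl

/-- All hands have size `S.card` exactly when, for every color `c`, player `c + 1` gets the same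
number of cards of color `c`. -/
theorem card_hand_eq_iff {n : ℕ} {S : Finset (Fin n)}
    {f : Fin 3 × Fin n → Option (Fin 3)} (hS : ∀ x, f x = none ↔ x.2 ∉ S)
    (hf : ∀ x p, f x = some p → p ≠ x.1) :
    (∀ p, (Finset.univ.filter fun x => f x = some p).card = S.card) ↔
      ∀ c, (dealtTo f c (c + 1)).card = (dealtTo f 0 1).card := by
  have h0 : (dealtTo f 0 1).card + (dealtTo f 0 2).card = S.card :=
    card_dealtTo_add_card_dealtTo hS hf 0
  have h1 : (dealtTo f 1 2).card + (dealtTo f 1 0).card = S.card :=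
    card_dealtTo_add_card_dealtTo hS hf 1
  have h2 : (dealtTo f 2 0).card + (dealtTo f 2 1).card = S.card :=
    card_dealtTo_add_card_dealtTo hS hf 2
  simp only [card_hand, Fin.forall_fin_succ, Fin.isValue, Fin.succ_zero_eq_one, Fin.succ_one_eq_two,
    dealtTo_self hf, Finset.card_empty, IsEmpty.forall_iff, and_true, true_and, zero_add,
    show (1 + 1 : Fin 3) = 2 from rfl, show (2 + 1 : Fin 3) = 0 from rfl]
  omega

/-- The deal with denominations `S` in which player `c + 1` gets the cards of color `c` with
denomination in `A c`. -/
def dealOf {n : ℕ} (S : Finset (Fin n)) (A : Fin 3 → Finset (Fin n)) (x : Fin 3 × Fin n) :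
    Option (Fin 3) :=
  if x.2 ∈ A x.1 then some (x.1 + 1) else if x.2 ∈ S then some (x.1 + 2) else none

theorem dealtTo_dealOf {n : ℕ} (S : Finset (Fin n)) (A : Fin 3 → Finset (Fin n)) (c : Fin 3) :
    dealtTo (dealOf S A) c (c + 1) = A c := by
  ext d
  simp only [dealtTo, dealOf, Finset.mem_filter, Finset.mem_univ, true_and]
  have : c + 2 ≠ c + 1 := by revert c; decide
  split_ifs <;> simp_all

theorem dealOf_eq_none_iff {n : ℕ} {S : Finset (Fin n)} {A : Fin 3 → Finset (Fin n)}
    (hA : ∀ c, A c ⊆ S) (x : Fin 3 × Fin n) : dealOf S A x = none ↔ x.2 ∉ S := by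
  have := @hA x.1 x.2
  unfold dealOf
  split_ifs <;> simp_all

theorem ne_of_dealOf_eq_some {n : ℕ} {S : Finset (Fin n)} {A : Fin 3 → Finset (Fin n)}
    (x : Fin 3 × Fin n) (p : Fin 3) (h : dealOf S A x = some p) : p ≠ x.1 := by
  have h1 : ∀ c : Fin 3, c + 1 ≠ c ∧ c + 2 ≠ c := by decide
  unfold dealOf at h
  split_ifs at h
  · exact Option.some.inj h ▸ (h1 x.1).1
  · exact Option.some.inj h ▸ (h1 x.1).2

theorem dealOf_dealtTo {n : ℕ} {S : Finset (Fin n)} {f : Fin 3 × Fin n → Option (Fin 3)}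
    (hS : ∀ x, f x = none ↔ x.2 ∉ S) (hf : ∀ x p, f x = some p → p ≠ x.1) :
    dealOf S (fun c => dealtTo f c (c + 1)) = f := by
  have h : ∀ c p : Fin 3, p ≠ c → p ≠ c + 1 → c + 2 = p := by decide
  funext ⟨c, d⟩
  have h1 := hS (c, d)
  have h2 := hf (c, d)
  simp only [dealOf, dealtTo, Finset.mem_filter, Finset.mem_univ, true_and]
  generalize f (c, d) = o at h1 h2
  rcases o with _ | p
  · simp_all
  · have h3 : d ∈ S := by simpa using h1
    simp only [Option.some.injEq, h3, if_true]
    split_ifs with h4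
    · rw [h4]
    · rw [h c p (h2 p rfl) h4]

theorem dealtTo_subset {n : ℕ} {S : Finset (Fin n)} {f : Fin 3 × Fin n → Option (Fin 3)}
    (hS : ∀ x, f x = none ↔ x.2 ∉ S) (c p : Fin 3) : dealtTo f c p ⊆ S := by
  intro d hd
  by_contra h
  simp [dealtTo, (hS (c, d)).2 h] at hd

open Finset in
theorem card_deals (n : ℕ) :
    (univ.filter (fun Sf : Finset (Fin n) × (Fin 3 × Fin n → Option (Fin 3)) =>
        (∀ x : Fin 3 × Fin n, Sf.2 x = none ↔ x.2 ∉ Sf.1) ∧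
        (∀ x : Fin 3 × Fin n, ∀ p : Fin 3, Sf.2 x = some p → p ≠ x.1) ∧
        (∀ p : Fin 3,
          (univ.filter (fun x : Fin 3 × Fin n => Sf.2 x = some p)).card = Sf.1.card))).card =
      ∑ k ∈ range (n + 1), n.choose k * ∑ j ∈ range (k + 1), (k.choose j) ^ 3 := by
  trans ((univ : Finset (Finset (Fin n))).sigma fun S => (range (S.card + 1)).sigma fun j =>
      Fintype.piFinset fun _ : Fin 3 => powersetCard j S).card
  · refine card_nbij' (fun Sf => ⟨Sf.1, (dealtTo Sf.2 0 1).card, fun c => dealtTo Sf.2 c (c + 1)⟩)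
      (fun t => (t.1, dealOf t.1 t.2.2)) ?_ ?_ ?_ ?_
    · rintro ⟨S, f⟩ h
      simp only [coe_filter, mem_univ, true_and, Set.mem_ofPred_eq] at h
      obtain ⟨hS, hf, hc⟩ := h
      simp only [mem_coe, mem_sigma, mem_univ, true_and, mem_range, Fintype.mem_piFinset,
        mem_powersetCard, Nat.lt_succ_iff]
      exact ⟨card_le_card (dealtTo_subset hS 0 1), fun c =>
        ⟨dealtTo_subset hS c _, (card_hand_eq_iff hS hf).1 hc c⟩⟩
    · rintro ⟨S, j, A⟩ h
      simp only [mem_coe, mem_sigma, mem_univ, true_and, mem_range, Fintype.mem_piFinset,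
        mem_powersetCard] at h
      have hS := dealOf_eq_none_iff fun c => (h.2 c).1
      simp only [coe_filter, mem_univ, true_and, Set.mem_ofPred_eq]
      refine ⟨hS, ne_of_dealOf_eq_some, (card_hand_eq_iff hS ne_of_dealOf_eq_some).2 fun c => ?_⟩
      have h0 : dealtTo (dealOf S A) 0 1 = A 0 := dealtTo_dealOf S A 0
      rw [dealtTo_dealOf, h0, (h.2 c).2, (h.2 0).2]
    · rintro ⟨S, f⟩ h
      simp only [coe_filter, mem_univ, true_and, Set.mem_ofPred_eq] at h
      simp only [dealOf_dealtTo h.1 h.2.1]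
    · rintro ⟨S, j, A⟩ h
      simp only [mem_coe, mem_sigma, mem_univ, true_and, mem_range, Fintype.mem_piFinset,
        mem_powersetCard] at h
      have h0 : dealtTo (dealOf S A) 0 1 = A 0 := dealtTo_dealOf S A 0
      simp only [dealtTo_dealOf, h0, (h.2 0).2]
  · simp only [card_sigma, Fintype.card_piFinset, card_powersetCard, prod_const, card_univ,
      Fintype.card_fin]
    rw [← powerset_univ,
      sum_powerset_apply_card (fun k => ∑ j ∈ range (k + 1), k.choose j ^ 3), card_univ,
      Fintype.card_fin]
    simp only [smul_eq_mul]

theorem total_deals_count (n : ℕ) :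
    (Finset.univ.filter (fun Sf : Finset (Fin n) × (Fin 3 × Fin n → Option (Fin 3)) =>
        (∀ x : Fin 3 × Fin n, Sf.2 x = none ↔ x.2 ∉ Sf.1) ∧
        (∀ x : Fin 3 × Fin n, ∀ p : Fin 3, Sf.2 x = some p → p ≠ x.1) ∧
        (∀ p : Fin 3,
          (Finset.univ.filter (fun x : Fin 3 × Fin n => Sf.2 x = some p)).card = Sf.1.card))).card =
      ∑ k ∈ Finset.range (n + 1), n.choose k * ∑ j ∈ Finset.range (k + 1), (k.choose j) ^ 3 ∧
    (Finset.univ.filter (fun Sf : Finset (Fin n) × (Fin 3 × Fin n → Option (Fin 3)) =>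
        (∀ x : Fin 3 × Fin n, Sf.2 x = none ↔ x.2 ∉ Sf.1) ∧
        (∀ x : Fin 3 × Fin n, ∀ p : Fin 3, Sf.2 x = some p → p ≠ x.1) ∧
        (∀ p : Fin 3,
          (Finset.univ.filter (fun x : Fin 3 × Fin n => Sf.2 x = some p)).card = Sf.1.card))).card =
      ∑ k ∈ Finset.range (n + 1), (n.choose k) ^ 2 * (2 * k).choose k :=
  ⟨card_deals n, (card_deals n).trans (sum_choose_mul_sum_choose_pow_three n)⟩
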